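/- arXiv:math/0209210 — 8 statements merged into one kernel-verified Lean document; each statement's English description precedes it below -/
import Mathlib

section
/- Let (F, G) be a matched pair of finite groups, k a field, σ and τ normalized 2-cocycles, and R the bicrossed product with the stated multiplication, unit, comultiplication and counit. Define the linear map S : R → R on basis elements by S(δ_g x) = σ_{(g◁x)⁻¹}((g▷x)⁻¹, g▷x)⁻¹ · τ_x(g⁻¹, g)⁻¹ · δ_{(g◁x)⁻¹}((g▷x)⁻¹). Then S is the inverse of the identity map with respect to the convolution product on End(R); that is, m ∘ (id ⊗ S) ∘ Δ = u ∘ ε and m ∘ (S ⊗ id) ∘ Δ = u ∘ ε, where m, Δ, ε are the structure maps of R and u : k → R sends 1 to the unit of R. -/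
open Finset

/-- In a matched pair, `(g ◁ x)⁻¹ = g⁻¹ ◁ (g ▷ x)`. -/
theorem inv_act_eq_act_inv {G F : Type*} [Group G]
    {act : G → F → G} {lact : G → F → F} (hlact_one : ∀ x, lact 1 x = x)
    (hcomp2 : ∀ s t x, act (s * t) x = act s (lact t x) * act t x) (g : G) (x : F) :
    (act g x)⁻¹ = act g⁻¹ (lact g x) := by
  have h_one : act 1 x = 1 := by
    have h := hcomp2 1 1 x
    rw [hlact_one, mul_one] at h
    exact left_eq_mul.mp h
  refine inv_eq_of_mul_eq_one_left ?_
  rw [← hcomp2, inv_mul_cancel, h_one]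

/-- Normalized cocycle identity `σ_{g◁x}(x⁻¹, x) = σ_g(x, x⁻¹)`. -/
theorem cocycle_act_inv_self {G F M : Type*} [Group F] [Group M]
    {act : G → F → G} {σ : G → F → F → M}
    (hσ : ∀ g x y z, σ (act g x) y z * σ g x (y * z) = σ g (x * y) z * σ g x y)
    (hσ_norm : ∀ g x, σ g x 1 = 1 ∧ σ g 1 x = 1) (g : G) (x : F) :
    σ (act g x) x⁻¹ x = σ g x x⁻¹ := by
  simpa [(hσ_norm _ _).1, (hσ_norm _ _).2] using hσ g x x⁻¹ x

/-- Normalized cocycle identity `τ_{g⁻¹▷x}(g⁻¹, g) = τ_x(g, g⁻¹)`. -/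
theorem cocycle_lact_inv_self {G F M : Type*} [Group G] [Group M]
    {lact : G → F → F} {τ : F → G → G → M}
    (hτ : ∀ x g h l, τ x (g * h) l * τ (lact l x) g h = τ x h l * τ x g (h * l))
    (hτ_norm : ∀ x g, τ x g 1 = 1 ∧ τ x 1 g = 1) (g : G) (x : F) :
    τ (lact g⁻¹ x) g⁻¹ g = τ x g g⁻¹ := by
  simpa [(hτ_norm _ _).1, (hτ_norm _ _).2] using hτ x g⁻¹ g g⁻¹

/-- The map `S(δ_g x) = σ_{(g◁x)⁻¹}((g▷x)⁻¹, g▷x)⁻¹ τ_x(g⁻¹,g)⁻¹ δ_{(g◁x)⁻¹} (g▷x)⁻¹`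
is a convolution inverse of the identity of the bicrossed product `R = k^G #^τ_σ kF`.
Here `R` is modelled as the function space `G × F → k`, with `δ_g x` the indicator
function of `(g, x)`; `mm` is the multiplication `R ⊗ R → R`, `Δ` the comultiplication,
and `(id ⊗ S) ∘ Δ` resp. `(S ⊗ id) ∘ Δ` are applied slotwise. The right-hand side
`(∑ x, r(1,x)) · 1_R` is `u(ε(r))`. -/
theorem stmt_3 {G F k : Type*} [Group G] [Group F] [Fintype G] [Fintype F]
    [DecidableEq G] [DecidableEq F] [Field k]
    (act : G → F → G) (lact : G → F → F)
    (hact_mul : ∀ g x y, act g (x * y) = act (act g x) y)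
    (hact_one : ∀ g, act g 1 = g)
    (hlact_mul : ∀ s t x, lact (s * t) x = lact s (lact t x))
    (hlact_one : ∀ x, lact 1 x = x)
    (hcomp1 : ∀ s x y, lact s (x * y) = lact s x * lact (act s x) y)
    (hcomp2 : ∀ s t x, act (s * t) x = act s (lact t x) * act t x)
    (σ : G → F → F → kˣ) (τ : F → G → G → kˣ)
    (hσ : ∀ g x y z, σ (act g x) y z * σ g x (y * z) = σ g (x * y) z * σ g x y)
    (hσ_norm : ∀ g x, σ g x 1 = 1 ∧ σ g 1 x = 1)
    (hτ : ∀ x g h l, τ x (g * h) l * τ (lact l x) g h = τ x h l * τ x g (h * l))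
    (hτ_norm : ∀ x g, τ x g 1 = 1 ∧ τ x 1 g = 1)
    -- the multiplication map `R ⊗ R → R`
    (mm : ((G × F) × (G × F) → k) → (G × F → k))
    (hmm : ∀ w p, mm w p = ∑ a : G × F, ∑ b : G × F,
      (if p.1 = a.1 ∧ b.1 = act a.1 a.2 ∧ p.2 = a.2 * b.2 then (σ a.1 a.2 b.2 : k) else 0)
        * w (a, b))
    -- the comultiplication map `Δ : R → R ⊗ R`
    (Δ : (G × F → k) → ((G × F) × (G × F) → k))
    (hΔ : ∀ u q, Δ u q = if q.1.2 = lact q.2.1 q.2.2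
      then (τ q.2.2 q.1.1 q.2.1 : k) * u (q.1.1 * q.2.1, q.2.2) else 0)
    -- the antipode candidate `S`
    (S : (G × F → k) → (G × F → k))
    (hS : ∀ u p, S u p = ∑ g : G, ∑ x : F,
      (if p = ((act g x)⁻¹, (lact g x)⁻¹)
        then (((σ ((act g x)⁻¹) ((lact g x)⁻¹) (lact g x))⁻¹ * (τ x g⁻¹ g)⁻¹ : kˣ) : k)
        else 0) * u (g, x)) :
    (∀ (r : G × F → k) (p : G × F),
        mm (fun q => S (fun q2 => Δ r (q.1, q2)) q.2) p
          = (∑ x : F, r (1, x)) * (if p.2 = 1 then 1 else 0)) ∧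
    (∀ (r : G × F → k) (p : G × F),
        mm (fun q => S (fun q1 => Δ r (q1, q.2)) q.1) p
          = (∑ x : F, r (1, x)) * (if p.2 = 1 then 1 else 0)) := by
  have inv_act := inv_act_eq_act_inv hlact_one hcomp2
  have act_cancel (g : G) (x : F) : act (act g x) x⁻¹ = g := by
    rw [← hact_mul, mul_inv_cancel, hact_one]
  have act_cancel' (g : G) (x : F) : act (act g x⁻¹) x = g := by
    rw [← hact_mul, inv_mul_cancel, hact_one]
  have lact_cancel (g : G) (x : F) : lact g⁻¹ (lact g x) = x := by
    rw [← hlact_mul, inv_mul_cancel, hlact_one]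
  have lact_cancel' (g : G) (x : F) : lact g (lact g⁻¹ x) = x := by
    rw [← hlact_mul, mul_inv_cancel, hlact_one]
  constructor
  · rintro r ⟨h, z⟩
    simp only [hmm, hS, hΔ, Finset.mul_sum, Finset.sum_mul]
    simp only [← Fintype.sum_prod_type']
    symm
    refine Fintype.sum_of_injective
      (fun x : F => ((h, lact h⁻¹ x), ((act h⁻¹ x)⁻¹, (lact h⁻¹ x)⁻¹), h⁻¹, x))
      (fun x y hxy => congrArg (fun q : (G × F) × (G × F) × G × F => q.2.2.2) hxy) _ _ ?_ ?_
    · rintro ⟨⟨t, y⟩, b, s, x⟩ hq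
      dsimp only
      split_ifs with h1 h2 h3
      any_goals simp only [mul_zero, zero_mul]
      obtain ⟨rfl, h1, -⟩ := h1
      subst h2 h3
      refine absurd ⟨x, ?_⟩ hq
      have hs : s⁻¹ = h := by
        dsimp only at h1
        rw [inv_act] at h1
        rw [← act_cancel s⁻¹ (lact s x), h1, act_cancel]
      subst hs
      simp only [inv_inv]
    · intro x
      have hσ' := cocycle_act_inv_self hσ hσ_norm h (lact h⁻¹ x)
      have hinv : (act h⁻¹ x)⁻¹ = act h (lact h⁻¹ x) := by rw [inv_act, inv_inv]
      simp only [hinv, hσ', inv_inv, mul_inv_cancel, true_and, if_true]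
      split_ifs <;> simp [mul_assoc]
  · rintro r ⟨h, z⟩
    simp only [hmm, hS, hΔ, Finset.mul_sum, Finset.sum_mul]
    simp only [← Fintype.sum_prod_type']
    symm
    refine Fintype.sum_of_injective
      (fun x : F => ((h, x⁻¹), (act h x⁻¹, x), (act h x⁻¹)⁻¹, lact (act h x⁻¹) x))
      (fun x y hxy => congrArg (fun q : (G × F) × (G × F) × G × F => q.2.1.2) hxy) _ _ ?_ ?_
    · rintro ⟨a, ⟨s, x⟩, g, y⟩ hq
      dsimp only
      split_ifs with h1 h2 h3
      any_goals simp only [mul_zero, zero_mul]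
      obtain ⟨h0, h1, -⟩ := h1
      subst h2 h3
      refine absurd ⟨x, ?_⟩ hq
      dsimp only at h0 h1
      rw [inv_act, act_cancel] at h1
      subst h1
      rw [inv_act, lact_cancel'] at h0
      subst h0
      simp only [act_cancel, inv_inv, lact_cancel', inv_act]
    · intro x
      obtain ⟨s, rfl⟩ : ∃ s, act s x = h := ⟨act h x⁻¹, act_cancel' h x⟩
      have hτ' := cocycle_lact_inv_self hτ hτ_norm s⁻¹ x
      have hl : lact s⁻¹ (lact s x) = x := lact_cancel s x
      simp only [inv_inv] at hτ'
      simp only [act_cancel, hl, inv_act, inv_inv, hτ', inv_mul_cancel, true_and, if_true]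
      split_ifs <;> simp [mul_assoc]
end

section
/- Let (F, G) be a matched pair of finite groups, k a field, σ and τ normalized 2-cocycles additionally satisfying σ_1(x,y) = 1 and τ_1(g,h) = 1 for all x, y ∈ F, g, h ∈ G, and R the bicrossed product. Let Q : G² × F² → kˣ be any map, written Q^{x,y}_{g,h}, and let c : R ⊗ R → R ⊗ R be the diagonal map c(δ_g x ⊗ δ_h y) = Q^{x,y}_{g,h} δ_h y ⊗ δ_g x. Then the comultiplication Δ : R → R ⊗ R is multiplicative with respect to the twisted product on R ⊗ R, i.e. Δ(uv) = Δ(u) • Δ(v) for all u, v ∈ R where (a ⊗ b) • (a' ⊗ b') := (m ⊗ m)(id ⊗ c ⊗ id)(a ⊗ b ⊗ a' ⊗ b'), if and only if the compatibility condition σ_{ts}(x,y) τ_{xy}(t,s) = Q^{x, (s◁x)▷y}_{s, t◁(s▷x)} · τ_x(t,s) · τ_y(t◁(s▷x), s◁x) · σ_t(s▷x, (s◁x)▷y) · σ_s(x,y) holds for all s, t ∈ G and x, y ∈ F. -/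
open Finset

/-- Summing against the structure constants of the bicrossed product leaves a single sum over the
group part of the first factor. -/
lemma sum_structureConstants_mul {G F k : Type*} [Group F] [Fintype G] [Fintype F]
    [DecidableEq G] [DecidableEq F] [CommSemiring k]
    (act : G → F → G) (σ : G → F → F → k) (p : G × F) (f : G × F → G × F → k) :
    ∑ a : G × F, ∑ b : G × F,
        (if p.1 = a.1 ∧ b.1 = act a.1 a.2 ∧ p.2 = a.2 * b.2 then σ a.1 a.2 b.2 else 0) * f a b =
      ∑ x, σ p.1 x (x⁻¹ * p.2) * f (p.1, x) (act p.1 x, x⁻¹ * p.2) := by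
  have key : ∀ a b : G × F,
      (if p.1 = a.1 ∧ b.1 = act a.1 a.2 ∧ p.2 = a.2 * b.2 then σ a.1 a.2 b.2 else 0) * f a b =
      if b = (act a.1 a.2, a.2⁻¹ * p.2) then
        (if p.1 = a.1 then σ a.1 a.2 (a.2⁻¹ * p.2) * f a (act a.1 a.2, a.2⁻¹ * p.2) else 0)
      else 0 := by
    rintro ⟨g, x⟩ ⟨h, y⟩
    have hy : p.2 = x * y ↔ y = x⁻¹ * p.2 := by
      rw [eq_inv_mul_iff_mul_eq, eq_comm]
    by_cases h1 : p.1 = g <;> by_cases h2 : h = act g x <;> by_cases h3 : y = x⁻¹ * p.2 <;>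
      simp [h1, h2, h3, hy]
  simp only [key, Finset.sum_ite_eq', Finset.mem_univ, if_true, Fintype.sum_prod_type]
  rw [Finset.sum_comm]
  simp

/-- Proposition (cond-q): the comultiplication `Δ` of the bicrossed product
`R = k^G #^τ_σ kF` is an algebra map for the product on `R ⊗ R` twisted by the diagonal
braiding `c(δ_g x ⊗ δ_h y) = Q^{x,y}_{g,h} δ_h y ⊗ δ_g x` if and only if
`σ_{ts}(x,y) τ_{xy}(t,s) = Q^{x,(s◁x)▷y}_{s,t◁(s▷x)} τ_x(t,s) τ_y(t◁(s▷x),s◁x)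
σ_t(s▷x,(s◁x)▷y) σ_s(x,y)`. Here `R` is modelled as `G × F → k`. -/
theorem stmt_4 {G F k : Type*} [Group G] [Group F] [Fintype G] [Fintype F]
    [DecidableEq G] [DecidableEq F] [Field k]
    (act : G → F → G) (lact : G → F → F)
    (hact_mul : ∀ g x y, act g (x * y) = act (act g x) y)
    (hact_one : ∀ g, act g 1 = g)
    (hlact_mul : ∀ s t x, lact (s * t) x = lact s (lact t x))
    (hlact_one : ∀ x, lact 1 x = x)
    (hcomp1 : ∀ s x y, lact s (x * y) = lact s x * lact (act s x) y)
    (hcomp2 : ∀ s t x, act (s * t) x = act s (lact t x) * act t x)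
    (σ : G → F → F → kˣ) (τ : F → G → G → kˣ)
    (hσ : ∀ g x y z, σ (act g x) y z * σ g x (y * z) = σ g (x * y) z * σ g x y)
    (hσ_norm : ∀ g x, σ g x 1 = 1 ∧ σ g 1 x = 1)
    (hσ_one : ∀ x y, σ 1 x y = 1)
    (hτ : ∀ x g h l, τ x (g * h) l * τ (lact l x) g h = τ x h l * τ x g (h * l))
    (hτ_norm : ∀ x g, τ x g 1 = 1 ∧ τ x 1 g = 1)
    (hτ_one : ∀ g h, τ 1 g h = 1)
    -- the braiding scalars `Q g h x y = Q^{x,y}_{g,h}`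
    (Q : G → G → F → F → kˣ)
    -- the matrix of the multiplication of `R`
    (mmat : (G × F) → (G × F) → (G × F) → k)
    (hmmat : ∀ a b p, mmat a b p =
      if p.1 = a.1 ∧ b.1 = act a.1 a.2 ∧ p.2 = a.2 * b.2 then (σ a.1 a.2 b.2 : k) else 0)
    -- the multiplication of `R`
    (mul : (G × F → k) → (G × F → k) → (G × F → k))
    (hmul : ∀ u v p, mul u v p = ∑ a : G × F, ∑ b : G × F, mmat a b p * u a * v b)
    -- the comultiplication of `R`
    (Δ : (G × F → k) → ((G × F) × (G × F) → k))
    (hΔ : ∀ u q, Δ u q = if q.1.2 = lact q.2.1 q.2.2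
      then (τ q.2.2 q.1.1 q.2.1 : k) * u (q.1.1 * q.2.1, q.2.2) else 0)
    -- the product of `R ⊗ R` twisted by the braiding: `(m ⊗ m)(id ⊗ c ⊗ id)`
    (bullet : ((G × F) × (G × F) → k) → ((G × F) × (G × F) → k) → ((G × F) × (G × F) → k))
    (hbullet : ∀ w w' r, bullet w w' r =
      ∑ p : G × F, ∑ a : G × F, ∑ b : G × F, ∑ q : G × F,
        (Q a.1 b.1 a.2 b.2 : k) * mmat p b r.1 * mmat a q r.2 * w (p, a) * w' (b, q)) :
    (∀ u v, Δ (mul u v) = bullet (Δ u) (Δ v)) ↔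
      (∀ (s t : G) (x y : F),
        σ (t * s) x y * τ (x * y) t s =
          Q s (act t (lact s x)) x (lact (act s x) y)
            * τ x t s * τ y (act t (lact s x)) (act s x)
            * σ t (lact s x) (lact (act s x) y) * σ s x y) := by
  have sum_mmat : ∀ (p : G × F) (f : G × F → G × F → k),
      ∑ a : G × F, ∑ b : G × F, mmat a b p * f a b =
        ∑ x, (σ p.1 x (x⁻¹ * p.2) : k) * f (p.1, x) (act p.1 x, x⁻¹ * p.2) := by
    intro p f
    simp only [hmmat]
    exact sum_structureConstants_mul act (fun g x y => (σ g x y : k)) p f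
  have mul_apply : ∀ u v (p : G × F), mul u v p =
      ∑ x, (σ p.1 x (x⁻¹ * p.2) : k) * (u (p.1, x) * v (act p.1 x, x⁻¹ * p.2)) := by
    intro u v p
    rw [← sum_mmat p (fun a b => u a * v b), hmul]
    simp only [mul_assoc]
  have bullet_apply : ∀ u v (t s : G) (z w : F), bullet (Δ u) (Δ v) ((t, z), (s, w)) =
      if z = lact s w then
        ∑ x, ((Q s (act t (lact s x)) x (lact (act s x) (x⁻¹ * w)) * τ x t s
            * τ (x⁻¹ * w) (act t (lact s x)) (act s x)
            * σ t (lact s x) (lact (act s x) (x⁻¹ * w)) * σ s x (x⁻¹ * w) : kˣ) : k) *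
          (u (t * s, x) * v (act (t * s) x, x⁻¹ * w))
      else 0 := by
    intro u v t s z w
    have hsum : bullet (Δ u) (Δ v) ((t, z), (s, w)) =
        ∑ p : G × F, ∑ b : G × F, mmat p b (t, z) * ∑ a : G × F, ∑ q : G × F,
          mmat a q (s, w) * ((Q a.1 b.1 a.2 b.2 : k) * Δ u (p, a) * Δ v (b, q)) := by
      rw [hbullet]
      refine Finset.sum_congr rfl fun p _ => ?_
      rw [Finset.sum_comm]
      refine Finset.sum_congr rfl fun b _ => ?_
      simp only [Finset.mul_sum]
      refine Finset.sum_congr rfl fun a _ => Finset.sum_congr rfl fun q _ => ?_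
      ring
    have hcond : ∀ x, (lact s x)⁻¹ * z = lact (act s x) (x⁻¹ * w) ↔ z = lact s w := by
      intro x
      rw [inv_mul_eq_iff_eq_mul, ← hcomp1, mul_inv_cancel_left]
    rw [hsum, sum_mmat (t, z) fun p b => ∑ a : G × F, ∑ q : G × F,
      mmat a q (s, w) * ((Q a.1 b.1 a.2 b.2 : k) * Δ u (p, a) * Δ v (b, q))]
    simp only [sum_mmat (s, w), Finset.mul_sum, hΔ]
    rw [Finset.sum_comm]
    simp only [mul_ite, ite_mul, mul_zero, zero_mul]
    split_ifs with hz
    · refine Finset.sum_congr rfl fun x _ => ?_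
      rw [Finset.sum_eq_single (lact s x) (fun b _ hb => by simp [hb]) (by simp)]
      simp only [(hcond x).2 hz, if_true, ← hcomp2]
      push_cast
      ring
    · refine Finset.sum_eq_zero fun x _ => Finset.sum_eq_zero fun b _ => ?_
      by_cases hb : b = lact s x
      · subst hb
        simp [hcond, hz]
      · simp [hb]
  constructor
  · intro h s t x y
    have h1 := congrFun (h (Pi.single (t * s, x) 1) (Pi.single (act (t * s) x, y) 1))
      ((t, lact s (x * y)), (s, x * y))
    rw [bullet_apply, hΔ, if_pos rfl, if_pos rfl, mul_apply,
      Finset.sum_eq_single x (fun b _ hb => by simp [hb]) (by simp),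
      Finset.sum_eq_single x (fun b _ hb => by simp [hb]) (by simp)] at h1
    simp only [inv_mul_cancel_left, Pi.single_eq_same, mul_one] at h1
    rw [mul_comm]
    exact_mod_cast h1
  · intro h u v
    funext ⟨⟨t, z⟩, s, w⟩
    rw [bullet_apply, hΔ, mul_apply]
    refine if_congr Iff.rfl ?_ rfl
    rw [Finset.mul_sum]
    refine Finset.sum_congr rfl fun x _ => ?_
    rw [← h s t x (x⁻¹ * w), mul_inv_cancel_left]
    push_cast
    ring
end

section
/- Let (F, G) be a matched pair of groups, k a field, and σ, τ normalized 2-cocycles additionally satisfying σ_1(x,y) = 1 and τ_1(g,h) = 1. A map Q : G² × F² → kˣ, written Q^{x,y}_{g,h}, satisfies the compatibility condition σ_{ts}(x,y) τ_{xy}(t,s) = Q^{x, (s◁x)▷y}_{s, t◁(s▷x)} · τ_x(t,s) · τ_y(t◁(s▷x), s◁x) · σ_t(s▷x, (s◁x)▷y) · σ_s(x,y) for all s, t ∈ G, x, y ∈ F, if and only if Q is given by the explicit formula Q^{x,y}_{g,h} = σ_{(h◁(g▷x)⁻¹)g}(x, (g◁x)⁻¹ ▷ y) · σ_{h◁(g▷x)⁻¹}(g▷x,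 y)⁻¹ · σ_g(x, (g◁x)⁻¹ ▷ y)⁻¹ · τ_{x·((g◁x)⁻¹ ▷ y)}(h◁(g▷x)⁻¹, g) · τ_{(g◁x)⁻¹ ▷ y}(h, g◁x)⁻¹ · τ_x(h◁(g▷x)⁻¹, g)⁻¹ for all g, h ∈ G, x, y ∈ F. In particular there is exactly one such map Q. -/
theorem mul_eq_mul_five_iff {A : Type*} [CommGroup A] (a b q c d e f : A) :
    a * b = q * c * d * e * f ↔ q = a * e⁻¹ * f⁻¹ * b * d⁻¹ * c⁻¹ := by
  simp only [eq_mul_inv_iff_mul_eq]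
  rw [show a * e⁻¹ * f⁻¹ * b = a * b * (f⁻¹ * e⁻¹) by ac_rfl, ← mul_inv_rev,
    eq_mul_inv_iff_mul_eq, ← mul_assoc, eq_comm]

/-- Proposition (const-struct): a family of scalars `Q^{x,y}_{g,h}` satisfies the
compatibility condition making the bicrossed product a prebraided Hopf algebra if and
only if `Q` is given by the explicit formula; in particular such a `Q` exists and is
unique. -/
theorem stmt_5 {G F k : Type*} [Group G] [Group F] [Field k]
    (act : G → F → G) (lact : G → F → F)
    (hact_mul : ∀ g x y, act g (x * y) = act (act g x) y)
    (hact_one : ∀ g, act g 1 = g)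
    (hlact_mul : ∀ s t x, lact (s * t) x = lact s (lact t x))
    (hlact_one : ∀ x, lact 1 x = x)
    (hcomp1 : ∀ s x y, lact s (x * y) = lact s x * lact (act s x) y)
    (hcomp2 : ∀ s t x, act (s * t) x = act s (lact t x) * act t x)
    (σ : G → F → F → kˣ) (τ : F → G → G → kˣ)
    (hσ : ∀ g x y z, σ (act g x) y z * σ g x (y * z) = σ g (x * y) z * σ g x y)
    (hσ_norm : ∀ g x, σ g x 1 = 1 ∧ σ g 1 x = 1)
    (hσ_one : ∀ x y, σ 1 x y = 1)
    (hτ : ∀ x g h l, τ x (g * h) l * τ (lact l x) g h = τ x h l * τ x g (h * l))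
    (hτ_norm : ∀ x g, τ x g 1 = 1 ∧ τ x 1 g = 1)
    (hτ_one : ∀ g h, τ 1 g h = 1)
    (Q : G → G → F → F → kˣ) :
    ((∀ (s t : G) (x y : F),
        σ (t * s) x y * τ (x * y) t s =
          Q s (act t (lact s x)) x (lact (act s x) y)
            * τ x t s * τ y (act t (lact s x)) (act s x)
            * σ t (lact s x) (lact (act s x) y) * σ s x y)
      ↔
      (∀ (g h : G) (x y : F),
        Q g h x y =
          σ (act h ((lact g x)⁻¹) * g) x (lact ((act g x)⁻¹) y)
            * (σ (act h ((lact g x)⁻¹)) (lact g x) y)⁻¹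
            * (σ g x (lact ((act g x)⁻¹) y))⁻¹
            * τ (x * lact ((act g x)⁻¹) y) (act h ((lact g x)⁻¹)) g
            * (τ (lact ((act g x)⁻¹) y) h (act g x))⁻¹
            * (τ x (act h ((lact g x)⁻¹)) g)⁻¹))
    ∧
    (∃! Q' : G → G → F → F → kˣ,
      ∀ (s t : G) (x y : F),
        σ (t * s) x y * τ (x * y) t s =
          Q' s (act t (lact s x)) x (lact (act s x) y)
            * τ x t s * τ y (act t (lact s x)) (act s x)
            * σ t (lact s x) (lact (act s x) y) * σ s x y) := by
  have act_inv_act : ∀ g x, act (act g x) x⁻¹ = g := fun g x => by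
    rw [← hact_mul, mul_inv_cancel, hact_one]
  have act_act_inv : ∀ g x, act (act g x⁻¹) x = g := fun g x => by
    rw [← hact_mul, inv_mul_cancel, hact_one]
  have lact_inv_lact : ∀ s x, lact s⁻¹ (lact s x) = x := fun s x => by
    rw [← hlact_mul, inv_mul_cancel, hlact_one]
  have lact_lact_inv : ∀ s x, lact s (lact s⁻¹ x) = x := fun s x => by
    rw [← hlact_mul, mul_inv_cancel, hlact_one]
  have compat_iff : ∀ Q : G → G → F → F → kˣ,
      (∀ (s t : G) (x y : F),
        σ (t * s) x y * τ (x * y) t s =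
          Q s (act t (lact s x)) x (lact (act s x) y)
            * τ x t s * τ y (act t (lact s x)) (act s x)
            * σ t (lact s x) (lact (act s x) y) * σ s x y)
      ↔
      (∀ (g h : G) (x y : F),
        Q g h x y =
          σ (act h ((lact g x)⁻¹) * g) x (lact ((act g x)⁻¹) y)
            * (σ (act h ((lact g x)⁻¹)) (lact g x) y)⁻¹
            * (σ g x (lact ((act g x)⁻¹) y))⁻¹
            * τ (x * lact ((act g x)⁻¹) y) (act h ((lact g x)⁻¹)) g
            * (τ (lact ((act g x)⁻¹) y) h (act g x))⁻¹
            * (τ x (act h ((lact g x)⁻¹)) g)⁻¹) := by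
    refine fun Q => ⟨fun hQ g h x y => ?_, fun hQ s t x y => ?_⟩
    · have hgh := hQ g (act h (lact g x)⁻¹) x (lact (act g x)⁻¹ y)
      rw [act_act_inv, lact_lact_inv] at hgh
      exact (mul_eq_mul_five_iff _ _ _ _ _ _ _).mp hgh
    · have hst := hQ s (act t (lact s x)) x (lact (act s x) y)
      rw [act_inv_act, lact_inv_lact] at hst
      exact (mul_eq_mul_five_iff _ _ _ _ _ _ _).mpr hst
  refine ⟨compat_iff Q, _, (compat_iff _).mpr fun _ _ _ _ => rfl, fun Q' hQ' => ?_⟩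
  funext g h x y
  exact (compat_iff Q').mp hQ' g h x y
end

section
/- Let (F, G) be a matched pair of finite groups, k a field, σ, τ normalized 2-cocycles with σ_1 = 1 and τ_1 = 1, R the bicrossed product, Q : G² × F² → kˣ a map, and c : R ⊗ R → R ⊗ R the diagonal map c(δ_g x ⊗ δ_h y) = Q^{x,y}_{g,h} δ_h y ⊗ δ_g x. Then the multiplication m : R ⊗ R → R commutes with c in the sense that c ∘ (id ⊗ m) = (m ⊗ id) ∘ (id ⊗ c) ∘ (c ⊗ id) and (id ⊗ m) ∘ (c ⊗ id) ∘ (id ⊗ c) = c ∘ (m ⊗ id), if and only if Q^{x, yz}_{g, s} = Q^{x, y}_{g, s} · Q^{x, z}_{g, s◁y} and Q^{xy, z}_{g, s} = Q^{x, z}_{g, s} · Q^{y, z}_{g◁x, s} for all x, y, z ∈ F and g, s ∈ G. -/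
open Finset

/-- Lemma (1-cociclos)(i): the multiplication of the bicrossed product `R` commutes with
the diagonal braiding `c(δ_g x ⊗ δ_h y) = Q^{x,y}_{g,h} δ_h y ⊗ δ_g x`, in the sense
`c ∘ (id ⊗ m) = (m ⊗ id) ∘ c_{1,2}` and `(id ⊗ m) ∘ c_{2,1} = c ∘ (m ⊗ id)`, if and only
if `Q^{x,yz}_{g,s} = Q^{x,y}_{g,s} Q^{x,z}_{g,s◁y}` and
`Q^{xy,z}_{g,s} = Q^{x,z}_{g,s} Q^{y,z}_{g◁x,s}`. -/
theorem stmt_6 {G F k : Type*} [Group G] [Group F] [Fintype G] [Fintype F]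
    [DecidableEq G] [DecidableEq F] [Field k]
    (act : G → F → G) (lact : G → F → F)
    (hact_mul : ∀ g x y, act g (x * y) = act (act g x) y)
    (hact_one : ∀ g, act g 1 = g)
    (hlact_mul : ∀ s t x, lact (s * t) x = lact s (lact t x))
    (hlact_one : ∀ x, lact 1 x = x)
    (hcomp1 : ∀ s x y, lact s (x * y) = lact s x * lact (act s x) y)
    (hcomp2 : ∀ s t x, act (s * t) x = act s (lact t x) * act t x)
    (σ : G → F → F → kˣ) (τ : F → G → G → kˣ)
    (hσ : ∀ g x y z, σ (act g x) y z * σ g x (y * z) = σ g (x * y) z * σ g x y)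
    (hσ_norm : ∀ g x, σ g x 1 = 1 ∧ σ g 1 x = 1)
    (hσ_one : ∀ x y, σ 1 x y = 1)
    (hτ : ∀ x g h l, τ x (g * h) l * τ (lact l x) g h = τ x h l * τ x g (h * l))
    (hτ_norm : ∀ x g, τ x g 1 = 1 ∧ τ x 1 g = 1)
    (hτ_one : ∀ g h, τ 1 g h = 1)
    (Q : G → G → F → F → kˣ)
    -- the matrix of the multiplication of `R`
    (mmat : (G × F) → (G × F) → (G × F) → k)
    (hmmat : ∀ a b p, mmat a b p =
      if p.1 = a.1 ∧ b.1 = act a.1 a.2 ∧ p.2 = a.2 * b.2 then (σ a.1 a.2 b.2 : k) else 0)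
    -- the braiding `c : R ⊗ R → R ⊗ R`
    (cmap : ((G × F) × (G × F) → k) → ((G × F) × (G × F) → k))
    (hcmap : ∀ w q, cmap w q = (Q q.2.1 q.1.1 q.2.2 q.1.2 : k) * w (q.2, q.1))
    -- `c_{1,2} = (id ⊗ c)(c ⊗ id) : R ⊗ R ⊗ R → R ⊗ R ⊗ R`
    (c12 : ((G × F) × (G × F) × (G × F) → k) → ((G × F) × (G × F) × (G × F) → k))
    (hc12 : ∀ w t, c12 w t =
      (Q t.2.2.1 t.1.1 t.2.2.2 t.1.2 : k) * (Q t.2.2.1 t.2.1.1 t.2.2.2 t.2.1.2 : k)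
        * w (t.2.2, t.1, t.2.1))
    -- `c_{2,1} = (c ⊗ id)(id ⊗ c) : R ⊗ R ⊗ R → R ⊗ R ⊗ R`
    (c21 : ((G × F) × (G × F) × (G × F) → k) → ((G × F) × (G × F) × (G × F) → k))
    (hc21 : ∀ w t, c21 w t =
      (Q t.2.2.1 t.1.1 t.2.2.2 t.1.2 : k) * (Q t.2.1.1 t.1.1 t.2.1.2 t.1.2 : k)
        * w (t.2.1, t.2.2, t.1))
    -- `id ⊗ m : R ⊗ R ⊗ R → R ⊗ R`
    (idm : ((G × F) × (G × F) × (G × F) → k) → ((G × F) × (G × F) → k))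
    (hidm : ∀ w q, idm w q = ∑ a : G × F, ∑ b : G × F, mmat a b q.2 * w (q.1, a, b))
    -- `m ⊗ id : R ⊗ R ⊗ R → R ⊗ R`
    (mid : ((G × F) × (G × F) × (G × F) → k) → ((G × F) × (G × F) → k))
    (hmid : ∀ w q, mid w q = ∑ a : G × F, ∑ b : G × F, mmat a b q.1 * w (a, b, q.2)) :
    ((∀ w, cmap (idm w) = mid (c12 w)) ∧ (∀ w, idm (c21 w) = cmap (mid w)))
      ↔
    ((∀ (x y z : F) (g s : G), Q g s x (y * z) = Q g s x y * Q g (act s y) x z) ∧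
     (∀ (x y z : F) (g s : G), Q g s (x * y) z = Q g s x z * Q (act g x) s y z)) := by
  constructor
  · rintro ⟨h1, h2⟩
    constructor
    · intro x y z g s
      have h := congrFun (h1 (fun t => if t.1 = (g, x) then if t.2.1 = (s, y) then
        if t.2.2 = (act s y, z) then 1 else 0 else 0 else 0)) ((s, y * z), (g, x))
      rw [hcmap, hidm, hmid] at h
      simp only [hc12, mul_ite, mul_one, mul_zero, if_true, Finset.sum_ite_eq',
        Finset.mem_univ, Finset.sum_const_zero, Finset.sum_ite_irrel, hmmat, and_self] at h
      have hs : (σ s y z : k) ≠ 0 := Units.ne_zero _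
      apply Units.ext
      push_cast
      exact mul_right_cancel₀ hs (h.trans (mul_comm _ _))
    · intro x y z g s
      have h := congrFun (h2 (fun t => if t.1 = (g, x) then if t.2.1 = (act g x, y) then
        if t.2.2 = (s, z) then 1 else 0 else 0 else 0)) ((s, z), (g, x * y))
      rw [hcmap, hidm, hmid] at h
      simp only [hc21, mul_ite, mul_one, mul_zero, if_true, Finset.sum_ite_eq',
        Finset.mem_univ, Finset.sum_const_zero, Finset.sum_ite_irrel, hmmat, and_self] at h
      have hs : (σ g x y : k) ≠ 0 := Units.ne_zero _
      apply Units.ext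
      push_cast
      refine mul_right_cancel₀ hs (h.symm.trans ?_)
      ring
  · rintro ⟨h1, h2⟩
    constructor
    · intro w
      funext q
      rw [hcmap, hidm, hmid, Finset.mul_sum]
      refine Finset.sum_congr rfl fun a _ => ?_
      rw [Finset.mul_sum]
      refine Finset.sum_congr rfl fun b _ => ?_
      rw [hc12, hmmat]
      split_ifs with h
      · obtain ⟨ha, hb, hp⟩ := h
        rw [ha, hb, hp, h1]
        push_cast
        ring
      · simp
    · intro w
      funext q
      rw [hcmap, hidm, hmid, Finset.mul_sum]
      refine Finset.sum_congr rfl fun a _ => ?_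
      rw [Finset.mul_sum]
      refine Finset.sum_congr rfl fun b _ => ?_
      rw [hc21, hmmat]
      split_ifs with h
      · obtain ⟨ha, hb, hp⟩ := h
        rw [ha, hb, hp, h2]
        push_cast
        ring
      · simp
end

section
/- Let (F, G) be a matched pair of finite groups, k a field, σ, τ normalized 2-cocycles with σ_1 = 1 and τ_1 = 1, R the bicrossed product, Q : G² × F² → kˣ a map, and c : R ⊗ R → R ⊗ R the diagonal map c(δ_g x ⊗ δ_h y) = Q^{x,y}_{g,h} δ_h y ⊗ δ_g x. Then the comultiplication Δ : R → R ⊗ R commutes with c in the sense that (Δ ⊗ id) ∘ c = (id ⊗ c) ∘ (c ⊗ id) ∘ (id ⊗ Δ) and (id ⊗ Δ) ∘ c = (c ⊗ id) ∘ (id ⊗ c) ∘ (Δ ⊗ id), if and only if Q^{x, y}_{g, ts} = Q^{x, s▷y}_{g, t} · Q^{x, y}_{g, s} and Q^{x, y}_{ts, g} = Q^{s▷x, y}_{t, g} · Q^{x, y}_{s, g} for all x, y ∈ F and g, t, s ∈ G. -/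
open Finset

/-- Lemma (1-cociclos)(ii): the comultiplication of the bicrossed product `R` commutes
with the diagonal braiding `c(δ_g x ⊗ δ_h y) = Q^{x,y}_{g,h} δ_h y ⊗ δ_g x`, in the
sense `(Δ ⊗ id) ∘ c = c_{1,2} ∘ (id ⊗ Δ)` and `(id ⊗ Δ) ∘ c = c_{2,1} ∘ (Δ ⊗ id)`, if
and only if `Q^{x,y}_{g,ts} = Q^{x,s▷y}_{g,t} Q^{x,y}_{g,s}` and
`Q^{x,y}_{ts,g} = Q^{s▷x,y}_{t,g} Q^{x,y}_{s,g}`. -/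
theorem stmt_7 {G F k : Type*} [Group G] [Group F] [Fintype G] [Fintype F]
    [DecidableEq G] [DecidableEq F] [Field k]
    (act : G → F → G) (lact : G → F → F)
    (hact_mul : ∀ g x y, act g (x * y) = act (act g x) y)
    (hact_one : ∀ g, act g 1 = g)
    (hlact_mul : ∀ s t x, lact (s * t) x = lact s (lact t x))
    (hlact_one : ∀ x, lact 1 x = x)
    (hcomp1 : ∀ s x y, lact s (x * y) = lact s x * lact (act s x) y)
    (hcomp2 : ∀ s t x, act (s * t) x = act s (lact t x) * act t x)
    (σ : G → F → F → kˣ) (τ : F → G → G → kˣ)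
    (hσ : ∀ g x y z, σ (act g x) y z * σ g x (y * z) = σ g (x * y) z * σ g x y)
    (hσ_norm : ∀ g x, σ g x 1 = 1 ∧ σ g 1 x = 1)
    (hσ_one : ∀ x y, σ 1 x y = 1)
    (hτ : ∀ x g h l, τ x (g * h) l * τ (lact l x) g h = τ x h l * τ x g (h * l))
    (hτ_norm : ∀ x g, τ x g 1 = 1 ∧ τ x 1 g = 1)
    (hτ_one : ∀ g h, τ 1 g h = 1)
    (Q : G → G → F → F → kˣ)
    -- the matrix of the comultiplication of `R`
    (dmat : (G × F) → ((G × F) × (G × F)) → k)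
    (hdmat : ∀ r q, dmat r q =
      if r.1 = q.1.1 * q.2.1 ∧ r.2 = q.2.2 ∧ q.1.2 = lact q.2.1 q.2.2
        then (τ r.2 q.1.1 q.2.1 : k) else 0)
    -- the braiding `c : R ⊗ R → R ⊗ R`
    (cmap : ((G × F) × (G × F) → k) → ((G × F) × (G × F) → k))
    (hcmap : ∀ w q, cmap w q = (Q q.2.1 q.1.1 q.2.2 q.1.2 : k) * w (q.2, q.1))
    -- `c_{1,2} = (id ⊗ c)(c ⊗ id)` and `c_{2,1} = (c ⊗ id)(id ⊗ c)`
    (c12 : ((G × F) × (G × F) × (G × F) → k) → ((G × F) × (G × F) × (G × F) → k))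
    (hc12 : ∀ w t, c12 w t =
      (Q t.2.2.1 t.1.1 t.2.2.2 t.1.2 : k) * (Q t.2.2.1 t.2.1.1 t.2.2.2 t.2.1.2 : k)
        * w (t.2.2, t.1, t.2.1))
    (c21 : ((G × F) × (G × F) × (G × F) → k) → ((G × F) × (G × F) × (G × F) → k))
    (hc21 : ∀ w t, c21 w t =
      (Q t.2.2.1 t.1.1 t.2.2.2 t.1.2 : k) * (Q t.2.1.1 t.1.1 t.2.1.2 t.1.2 : k)
        * w (t.2.1, t.2.2, t.1))
    -- `Δ ⊗ id : R ⊗ R → R ⊗ R ⊗ R`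
    (did : ((G × F) × (G × F) → k) → ((G × F) × (G × F) × (G × F) → k))
    (hdid : ∀ w t, did w t = ∑ a : G × F, dmat a (t.1, t.2.1) * w (a, t.2.2))
    -- `id ⊗ Δ : R ⊗ R → R ⊗ R ⊗ R`
    (idd : ((G × F) × (G × F) → k) → ((G × F) × (G × F) × (G × F) → k))
    (hidd : ∀ w t, idd w t = ∑ b : G × F, dmat b (t.2.1, t.2.2) * w (t.1, b)) :
    ((∀ w, did (cmap w) = c12 (idd w)) ∧ (∀ w, idd (cmap w) = c21 (did w)))
      ↔
    ((∀ (x y : F) (g t s : G), Q g (t * s) x y = Q g t x (lact s y) * Q g s x y) ∧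
     (∀ (x y : F) (g t s : G), Q (t * s) g x y = Q t g (lact s x) y * Q s g x y)) := by
  have hsum : ∀ (p q : G × F) (f : G × F → k), ∑ a : G × F, dmat a (p, q) * f a =
      if p.2 = lact q.1 q.2 then (τ q.2 p.1 q.1 : k) * f (p.1 * q.1, q.2) else 0 := by
    intro p q f
    rw [Finset.sum_eq_single (p.1 * q.1, q.2)]
    · simp [hdmat]
    · rintro ⟨a, x⟩ - hne
      rw [hdmat, if_neg, zero_mul]
      rintro ⟨h₁, h₂, -⟩
      exact hne (Prod.ext h₁ h₂)
    · simp
  constructor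
  · rintro ⟨h₁, h₂⟩
    constructor
    · intro x y g t s
      have h := congrFun (h₁ fun _ => 1) ((t, lact s y), (s, y), (g, x))
      simp only [hdid, hc12, hidd, hsum, hcmap, if_true] at h
      rw [mul_one, mul_one, mul_comm] at h
      exact Units.ext (mul_right_cancel₀ (Units.ne_zero _) h)
    · intro x y g t s
      have h := congrFun (h₂ fun _ => 1) ((g, y), (t, lact s x), (s, x))
      simp only [hdid, hc21, hidd, hsum, hcmap, if_true] at h
      rw [mul_one, mul_one, mul_comm] at h
      rw [mul_comm (Q t g _ _)]
      exact Units.ext (mul_right_cancel₀ (Units.ne_zero _) h)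
  · rintro ⟨h₁, h₂⟩
    constructor
    · rintro w
      funext ⟨⟨t, z⟩, ⟨s, y⟩, ⟨g, x⟩⟩
      simp only [hdid, hc12, hidd, hsum, hcmap]
      split_ifs with hz
      · rw [h₁, hz, Units.val_mul]
        ring
      · simp
    · rintro w
      funext ⟨⟨g, y⟩, ⟨t, z⟩, ⟨s, x⟩⟩
      simp only [hdid, hc21, hidd, hsum, hcmap]
      split_ifs with hz
      · rw [h₂, hz, Units.val_mul]
        ring
      · simp
end

section
/- Let p be an odd prime and let a, b be residues modulo p with ab ≢ 0 (mod p). Let F = G = 𝔽_p ⊕ 𝔽_p (written additively) with both actions of the matched pair trivial, and work over ℂ. Define τ_{(x,y)}((α,β),(α',β')) = exp((2πi/p)(x+y)(αβ' − α'β)) and σ_{(α,β)}((x,y),(x',y')) = exp((2πi/p)(aα² + bβ²)(xy' − x'y)). Then: (1) σ and τ are normalized 2-cocycles with σ_0 = 1 and τ_0 = 1; (2) the canonical braiding scalar Q equals Q^{(x,y),(x',y')}_{(α,β),(α',β')} = exp((4πi/p)(aαα' + bββ')(xy' − x'y)); (3) Q satisfies the four multiplicativity conditions (so the associated bicrossed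 product is a braided Hopf algebra with braiding determined by Q); (4) Q is not identically 1; and (5) the bicrossed product R is neither commutative (there exist u, v ∈ R with uv ≠ vu) nor cocommutative (Δ ≠ flip ∘ Δ). -/
open Finset

/-- Proposition (trivial-actions): for an odd prime `p`, `a b ∈ 𝔽_p` with `ab ≠ 0`,
`F = G = 𝔽_p ⊕ 𝔽_p` with trivial actions, and the cocycles
`τ_{(x,y)}((α,β),(α',β')) = exp((2πi/p)(x+y)(αβ'-α'β))` and
`σ_{(α,β)}((x,y),(x',y')) = exp((2πi/p)(aα²+bβ²)(xy'-x'y))`, the associated bicrossed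
product is a braided Hopf algebra with non-trivial braiding
`Q = exp((4πi/p)(aαα'+bββ')(xy'-x'y))`, and it is neither commutative nor
cocommutative. -/
theorem stmt_10 (p : ℕ) [Fact p.Prime] [NeZero p] (hodd : Odd p)
    (a b : ZMod p) (hab : a * b ≠ 0)
    -- `e c = exp(2πi c/p)`
    (e : ZMod p → ℂ)
    (he : ∀ c : ZMod p, e c = Complex.exp (2 * (Real.pi : ℂ) * Complex.I * (c.val : ℂ) / (p : ℂ)))
    (σ : ZMod p × ZMod p → ZMod p × ZMod p → ZMod p × ZMod p → ℂ)
    (hσdef : ∀ g x y, σ g x y = e ((a * g.1 ^ 2 + b * g.2 ^ 2) * (x.1 * y.2 - x.2 * y.1)))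
    (τ : ZMod p × ZMod p → ZMod p × ZMod p → ZMod p × ZMod p → ℂ)
    (hτdef : ∀ x t s, τ x t s = e ((x.1 + x.2) * (t.1 * s.2 - t.2 * s.1)))
    -- the canonical braiding scalar for trivial actions: `Q = ∂σ(h,g)(x,y) ∂τ(x,y)(h,g)`
    (Q : ZMod p × ZMod p → ZMod p × ZMod p → ZMod p × ZMod p → ZMod p × ZMod p → ℂ)
    (hQdef : ∀ g h x y, Q g h x y =
      (σ (h + g) x y * (σ h x y)⁻¹ * (σ g x y)⁻¹)
        * (τ (x + y) h g * (τ x h g)⁻¹ * (τ y h g)⁻¹))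
    -- multiplication and comultiplication of the bicrossed product `R` (trivial actions)
    (mul : ((ZMod p × ZMod p) × (ZMod p × ZMod p) → ℂ) →
      ((ZMod p × ZMod p) × (ZMod p × ZMod p) → ℂ) →
      ((ZMod p × ZMod p) × (ZMod p × ZMod p) → ℂ))
    (hmul : ∀ u v q, mul u v q = ∑ x : ZMod p × ZMod p, ∑ y : ZMod p × ZMod p,
      if x + y = q.2 then σ q.1 x y * u (q.1, x) * v (q.1, y) else 0)
    (Δ : ((ZMod p × ZMod p) × (ZMod p × ZMod p) → ℂ) →
      (((ZMod p × ZMod p) × (ZMod p × ZMod p)) × ((ZMod p × ZMod p) × (ZMod p × ZMod p)) → ℂ))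
    (hΔ : ∀ u q, Δ u q = if q.1.2 = q.2.2
      then τ q.2.2 q.1.1 q.2.1 * u (q.1.1 + q.2.1, q.2.2) else 0) :
    -- (1) σ and τ are normalized 2-cocycles with σ_0 = 1 and τ_0 = 1
    ((∀ g x y z, σ g x y * σ g (x + y) z = σ g y z * σ g x (y + z)) ∧
     (∀ g x, σ g x 0 = 1 ∧ σ g 0 x = 1) ∧ (∀ x y, σ 0 x y = 1) ∧
     (∀ x g h l, τ x g h * τ x (g + h) l = τ x h l * τ x g (h + l)) ∧
     (∀ x g, τ x g 0 = 1 ∧ τ x 0 g = 1) ∧ (∀ g h, τ 0 g h = 1)) ∧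
    -- (2) the canonical braiding scalar
    (∀ g h x y, Q g h x y =
      e (2 * (a * g.1 * h.1 + b * g.2 * h.2) * (x.1 * y.2 - x.2 * y.1))) ∧
    -- (3) the four multiplicativity conditions
    ((∀ g s x y z, Q g s x (y + z) = Q g s x y * Q g s x z) ∧
     (∀ g s x y z, Q g s (x + y) z = Q g s x z * Q g s y z) ∧
     (∀ g t s x y, Q g (t + s) x y = Q g t x y * Q g s x y) ∧
     (∀ g t s x y, Q (t + s) g x y = Q t g x y * Q s g x y)) ∧
    -- (4) the braiding is non-trivial
    (∃ g h x y, Q g h x y ≠ 1) ∧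
    -- (5) `R` is neither commutative nor cocommutative
    (∃ u v, mul u v ≠ mul v u) ∧
    (∃ u, Δ u ≠ fun q => Δ u (q.2, q.1)) := by
  have he' : e = fun c => (ZMod.stdAddChar c : ℂ) := by
    funext c
    rw [he, ZMod.stdAddChar_apply, ZMod.toCircle_apply]
  have he0 : e 0 = 1 := by simp [he']
  have hadd : ∀ c d, e (c + d) = e c * e d := fun c d => by
    simp [he', AddChar.map_add_eq_mul]
  have hinv : ∀ c, (e c)⁻¹ = e (-c) := fun c => by
    simp [he', AddChar.map_neg_eq_inv]
  have hinj : Function.Injective e := by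
    rw [he']
    exact ZMod.injective_stdAddChar
  have ha : a ≠ 0 := left_ne_zero_of_mul hab
  have h2 : (2 : ZMod p) ≠ 0 := by
    have : Fact (p ≠ 2) := ⟨by rintro rfl; exact absurd hodd (by decide)⟩
    exact Ring.two_ne_zero (by rw [ZMod.ringChar_zmod_n]; exact this.out)
  have hneg : ∀ c : ZMod p, c ≠ 0 → e c ≠ e (-c) := fun c hc h => by
    have h' : 2 * c = 0 := by linear_combination hinj h
    exact (mul_ne_zero h2 hc) h'
  have hQ : ∀ g h x y, Q g h x y =
      e (2 * (a * g.1 * h.1 + b * g.2 * h.2) * (x.1 * y.2 - x.2 * y.1)) := by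
    intro g h x y
    simp only [hQdef, hσdef, hτdef, hinv, ← hadd, Prod.fst_add, Prod.snd_add]
    congr 1
    ring
  have hbasis : ∀ g x y, mul (Pi.single (g, x) 1) (Pi.single (g, y) 1) (g, x + y) = σ g x y := by
    intro g x y
    rw [hmul, Finset.sum_eq_single x, Finset.sum_eq_single y]
    · simp
    · intro y' _ hy'
      simp [hy']
    · simp
    · intro x' _ hx'
      simp [Pi.single_apply, hx']
    · simp
  refine ⟨⟨?_, ?_, ?_, ?_, ?_, ?_⟩, hQ, ⟨?_, ?_, ?_, ?_⟩, ?_, ?_, ?_⟩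
  · intro g x y z
    simp only [hσdef, ← hadd, Prod.fst_add, Prod.snd_add]
    congr 1
    ring
  · intro g x
    simp [hσdef, he0]
  · intro x y
    simp [hσdef, he0]
  · intro x g h l
    simp only [hτdef, ← hadd, Prod.fst_add, Prod.snd_add]
    congr 1
    ring
  · intro x g
    simp [hτdef, he0]
  · intro g h
    simp [hτdef, he0]
  iterate 4
    · intros
      simp only [hQ, ← hadd, Prod.fst_add, Prod.snd_add]
      congr 1
      ring
  · refine ⟨(1, 0), (1, 0), (1, 0), (0, 1), ?_⟩
    rw [hQ, ← he0]
    exact hinj.ne (by simpa using ⟨h2, ha⟩)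
  · refine ⟨Pi.single ((1, 0), (1, 0)) 1, Pi.single ((1, 0), (0, 1)) 1, fun h => hneg a ha ?_⟩
    have h' := congrFun h ((1, 0), (1, 0) + (0, 1))
    rw [hbasis, add_comm ((1, 0) : ZMod p × ZMod p), hbasis, hσdef, hσdef] at h'
    simpa using h'
  · refine ⟨fun _ => 1, fun h => hneg 1 one_ne_zero ?_⟩
    have h' := congrFun h (((1, 0), (1, 0)), ((0, 1), (1, 0)))
    simpa [hΔ, hτdef] using h'
end

section
/- Let (F, G) be a matched pair of groups with F cyclic of order N generated by a, and let A be an abelian group. For h ∈ G write h ▷ a = a^{h(1)} with h(1) ∈ {0, 1, …, N−1}. Then the assignment γ ↦ α, where α(g, aⁱ) := γ(g) γ(g◁a) ⋯ γ(g◁a^{i−1}) for 0 ≤ i ≤ N−1 (empty product = 1), is a bijection from the set of maps γ : G → A satisfying (gama1) γ(g) γ(g◁a) ⋯ γ(g◁a^{N−1}) = 1 for all g ∈ G, and (gama2) γ(gh) = γ(g) γ(g◁a) ⋯ γ(g◁a^{h(1)−1}) γ(h) for all g, h ∈ G, onto the set of maps α : G × F → A satisfying α(g, xy) = α(g, x)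 α(g◁x, y) and α(gh, x) = α(g, h▷x) α(h, x) for all g, h ∈ G and x, y ∈ F. -/
open Finset

/-- Telescoping a one-cocycle for a right action along the powers of an element. -/
theorem cocycle_pow_eq_prod {G F A : Type*} [Group F] [CommGroup A]
    (act : G → F → G) (hact_one : ∀ g, act g 1 = g) (α : G → F → A)
    (hα : ∀ g x y, α g (x * y) = α g x * α (act g x) y) (a : F) (g : G) (i : ℕ) :
    α g (a ^ i) = ∏ j ∈ Finset.range i, α (act g (a ^ j)) a := by
  induction i with
  | zero =>
    have h := hα g 1 1
    rw [hact_one, mul_one, left_eq_mul] at h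
    simpa using h
  | succ i ih => rw [pow_succ, hα, ih, Finset.prod_range_succ]

/-- Products along an orbit of a right action split as a cocycle. -/
theorem prod_act_pow_add {G F A : Type*} [Group F] [CommGroup A]
    (act : G → F → G) (hact_mul : ∀ g x y, act g (x * y) = act (act g x) y)
    (γ : G → A) (a : F) (g : G) (i k : ℕ) :
    ∏ j ∈ Finset.range (i + k), γ (act g (a ^ j)) =
      (∏ j ∈ Finset.range i, γ (act g (a ^ j))) *
        ∏ j ∈ Finset.range k, γ (act (act g (a ^ i)) (a ^ j)) := by
  rw [Finset.prod_range_add]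
  simp only [pow_add, hact_mul]

/-- If the products over full periods are trivial, an orbit product depends only on the
exponent modulo the period. -/
theorem prod_act_pow_mod {G F A : Type*} [Group F] [CommGroup A]
    (act : G → F → G) (hact_one : ∀ g, act g 1 = g)
    (hact_mul : ∀ g x y, act g (x * y) = act (act g x) y)
    (γ : G → A) (a : F) (N : ℕ) (haN : a ^ N = 1)
    (hγ : ∀ g, ∏ j ∈ Finset.range N, γ (act g (a ^ j)) = 1) (g : G) (i : ℕ) :
    ∏ j ∈ Finset.range (i % N), γ (act g (a ^ j)) =
      ∏ j ∈ Finset.range i, γ (act g (a ^ j)) := by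
  have hmul : ∀ q, ∏ j ∈ Finset.range (N * q), γ (act g (a ^ j)) = 1 := by
    intro q
    induction q with
    | zero => simp
    | succ q ih => rw [Nat.mul_succ, prod_act_pow_add act hact_mul, ih, hγ, one_mul]
  conv_rhs => rw [← Nat.div_add_mod i N, prod_act_pow_add act hact_mul, hmul, pow_mul, haN,
    one_pow, hact_one, one_mul]

/-- Lemma (diag-cyclic): for a matched pair `(F, G)` with `F = ⟨a⟩` cyclic of order `N`
and an abelian group `A`, the assignment `γ ↦ α`, `α(g, aⁱ) = γ(g) γ(g◁a) ⋯ γ(g◁a^{i-1})`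
(`0 ≤ i ≤ N-1`), is a bijection from the set of maps `γ : G → A` satisfying (gama1) and
(gama2) onto the set of maps `α : G × F → A` satisfying
`α(g,xy) = α(g,x) α(g◁x,y)` and `α(gh,x) = α(g,h▷x) α(h,x)`. Here `h ▷ a = a^{e h}` with
`e h < N`. -/
theorem stmt_18 {G F A : Type*} [Group G] [Group F] [CommGroup A]
    (act : G → F → G) (lact : G → F → F)
    (hact_mul : ∀ g x y, act g (x * y) = act (act g x) y)
    (hact_one : ∀ g, act g 1 = g)
    (hlact_mul : ∀ s t x, lact (s * t) x = lact s (lact t x))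
    (hlact_one : ∀ x, lact 1 x = x)
    (hcomp1 : ∀ s x y, lact s (x * y) = lact s x * lact (act s x) y)
    (hcomp2 : ∀ s t x, act (s * t) x = act s (lact t x) * act t x)
    (N : ℕ) (a : F)
    (hord : orderOf a = N)
    (hgen : ∀ x : F, ∃ i < N, x = a ^ i)
    (e : G → ℕ)
    (he_lt : ∀ h, e h < N)
    (he : ∀ h, lact h a = a ^ e h) :
    (∀ γ : G → A,
      ((∀ g, ∏ j ∈ Finset.range N, γ (act g (a ^ j)) = 1) ∧
       (∀ g h, γ (g * h) = (∏ j ∈ Finset.range (e h), γ (act g (a ^ j))) * γ h)) →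
      ∃! α : G → F → A,
        ((∀ g x y, α g (x * y) = α g x * α (act g x) y) ∧
         (∀ g h x, α (g * h) x = α g (lact h x) * α h x)) ∧
        (∀ g, ∀ i < N, α g (a ^ i) = ∏ j ∈ Finset.range i, γ (act g (a ^ j)))) ∧
    (∀ α : G → F → A,
      ((∀ g x y, α g (x * y) = α g x * α (act g x) y) ∧
       (∀ g h x, α (g * h) x = α g (lact h x) * α h x)) →
      ∃! γ : G → A,
        ((∀ g, ∏ j ∈ Finset.range N, γ (act g (a ^ j)) = 1) ∧
         (∀ g h, γ (g * h) = (∏ j ∈ Finset.range (e h), γ (act g (a ^ j))) * γ h)) ∧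
        (∀ g, ∀ i < N, α g (a ^ i) = ∏ j ∈ Finset.range i, γ (act g (a ^ j)))) := by
  have haN : a ^ N = 1 := hord ▸ pow_orderOf_eq_one a
  have hlact1 : ∀ h, lact h 1 = 1 := by
    intro h
    have h1 := hcomp1 h 1 1
    rwa [hact_one, mul_one, left_eq_mul] at h1
  constructor
  · rintro γ ⟨hγ1, hγ2⟩
    choose n hn_lt hn using hgen
    have hval : ∀ g i, ∏ j ∈ Finset.range (n (a ^ i)), γ (act g (a ^ j)) =
        ∏ j ∈ Finset.range i, γ (act g (a ^ j)) := by
      intro g i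
      have hmod : n (a ^ i) % N = i % N := by
        have h := pow_eq_pow_iff_modEq.mp (hn (a ^ i))
        rw [hord] at h
        exact h.symm
      rw [← prod_act_pow_mod act hact_one hact_mul γ a N haN hγ1 g (n (a ^ i)), hmod,
        prod_act_pow_mod act hact_one hact_mul γ a N haN hγ1]
    obtain ⟨α, hα⟩ : ∃ α : G → F → A,
        ∀ g i, α g (a ^ i) = ∏ j ∈ Finset.range i, γ (act g (a ^ j)) :=
      ⟨fun g x => ∏ j ∈ Finset.range (n x), γ (act g (a ^ j)), hval⟩
    have hα1 : ∀ g x y, α g (x * y) = α g x * α (act g x) y := by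
      intro g x y
      rw [hn x, hn y, ← pow_add, hα, hα, hα, prod_act_pow_add act hact_mul]
    have hαa : ∀ g, α g a = γ g := by
      intro g
      simpa [hact_one] using hα g 1
    have hαone : ∀ g, α g 1 = 1 := by
      intro g
      simpa using hα g 0
    have hpow : ∀ g h i, α (g * h) (a ^ i) = α g (lact h (a ^ i)) * α h (a ^ i) := by
      intro g h i
      induction i with
      | zero => simp [hlact1, hαone]
      | succ i ih =>
        rw [pow_succ, hα1, ih, hcomp2, hαa, hγ2, ← hα, ← he, hcomp1, hα1, hα1 h, hαa,
          mul_mul_mul_comm]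
    refine ⟨α, ⟨⟨hα1, fun g h x => ?_⟩, fun g i _ => hα g i⟩, ?_⟩
    · rw [hn x]
      exact hpow g h _
    · rintro β ⟨-, hβ⟩
      funext g x
      rw [hn x, hβ g _ (hn_lt x), hα]
  · rintro α ⟨hα1, hα2⟩
    have hα := cocycle_pow_eq_prod act hact_one α hα1 a
    refine ⟨fun g => α g a, ⟨⟨fun g => ?_, fun g h => ?_⟩, fun g i _ => hα g i⟩, ?_⟩
    · rw [← hα, haN]
      simpa using hα g 0
    · change α (g * h) a = _ * α h a
      rw [← hα, ← he, hα2]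
    · rintro γ ⟨⟨hγ1, -⟩, hγ⟩
      funext g
      have key : α g (a ^ 1) = ∏ j ∈ Finset.range 1, γ (act g (a ^ j)) := by
        obtain hN | rfl : 1 < N ∨ N = 1 := by
          have := he_lt 1
          omega
        · exact hγ g 1 hN
        · rw [hγ1, haN]
          simpa using hα g 0
      simpa [hact_one] using key.symm
end

section
/- Let (F, G) be a matched pair of finite groups, k a field, σ, τ and σ', τ' two pairs of normalized 2-cocycles with σ_1 = σ'_1 = 1 and τ_1 = τ'_1 = 1, and let R = k^G #^τ_σ kF and R' = k^G #^{τ'}_{σ'} kF be the corresponding bicrossed products (same underlying vector space with basis {δ_g x}, with multiplications given by σ, σ' and comultiplications given by τ, τ' respectively). Let ν : G × F → kˣ satisfy ν(1, x) = 1 = ν(g, 1), and define the linear map Θ : R → R' by Θ(δ_g x) = ν(g, x) δ_g x. Then Θ is an isomorphism of extensions — i.e. Θ is bijective, preserves multiplication and comultiplication, restricts to the identity on the span of {δ_g 1 : g ∈ G}, and satisfies π' ∘ Θ = π where π, π' are the canonical projections δ_g x ↦ [g = 1] x onto kF — if and only if σ_g(x, y) ν(g, xy) = σ'_g(x, y)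 ν(g, x) ν(g◁x, y) and τ'_x(g, h) ν(gh, x) = τ_x(g, h) ν(g, h▷x) ν(h, x) for all g, h ∈ G, x, y ∈ F. Moreover, every isomorphism of extensions Θ : R → R' arises in this way from a unique such ν. -/
open Finset

theorem bicrossed_mul_apply {G F k : Type*} [Group F] [Fintype G] [Fintype F]
    [DecidableEq G] [DecidableEq F] [Field k]
    (act : G → F → G) (σ : G → F → F → kˣ) (u v : G × F → k) (p : G × F) :
    (∑ a : G × F, ∑ b : G × F,
      (if p.1 = a.1 ∧ b.1 = act a.1 a.2 ∧ p.2 = a.2 * b.2 then (σ a.1 a.2 b.2 : k) else 0)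
        * u a * v b) =
    ∑ x : F, (σ p.1 x (x⁻¹ * p.2) : k) * u (p.1, x) * v (act p.1 x, x⁻¹ * p.2) := by
  rw [Fintype.sum_prod_type, Finset.sum_eq_single p.1]
  · refine Finset.sum_congr rfl fun x _ => ?_
    rw [Finset.sum_eq_single (act p.1 x, x⁻¹ * p.2)]
    · simp
    · rintro ⟨h, y⟩ - hne
      rw [if_neg, zero_mul, zero_mul]
      rintro ⟨-, h1, h2⟩
      exact hne (Prod.ext h1 (by simp [h2]))
    · simp
  · intro g _ hg
    refine Finset.sum_eq_zero fun x _ => Finset.sum_eq_zero fun b _ => ?_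
    rw [if_neg fun h => hg h.1.symm, zero_mul, zero_mul]
  · simp

/-- Left multiplication by `δ_g 1` is the projection onto the span of `{δ_g x : x ∈ F}`. -/
theorem bicrossed_single_one_mul_apply {G F k : Type*} [Group F] [Fintype G] [Fintype F]
    [DecidableEq G] [DecidableEq F] [Field k]
    (act : G → F → G) (hact_one : ∀ g, act g 1 = g)
    (σ : G → F → F → kˣ) (hσ_norm : ∀ g x, σ g x 1 = 1 ∧ σ g 1 x = 1)
    (g : G) (v : G × F → k) (p : G × F) :
    (∑ a : G × F, ∑ b : G × F,
      (if p.1 = a.1 ∧ b.1 = act a.1 a.2 ∧ p.2 = a.2 * b.2 then (σ a.1 a.2 b.2 : k) else 0)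
        * (Pi.single (g, 1) 1 : G × F → k) a * v b) = if p.1 = g then v p else 0 := by
  rw [bicrossed_mul_apply, Finset.sum_eq_single 1]
  · by_cases h : p.1 = g
    · subst h
      simp [hact_one, (hσ_norm _ _).2]
    · simp [h]
  · intro x _ hx
    simp [hx]
  · simp

/-- Proposition (prop-equiv): the diagonal map `Θ(δ_g x) = ν(g,x) δ_g x` is an
isomorphism of extensions `R = k^G #^τ_σ kF → R' = k^G #^{τ'}_{σ'} kF` if and only if
`σ_g(x,y) ν(g,xy) = σ'_g(x,y) ν(g,x) ν(g◁x,y)` and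
`τ'_x(g,h) ν(gh,x) = τ_x(g,h) ν(g,h▷x) ν(h,x)`; moreover, every isomorphism of
extensions arises in this way from a unique `ν`. Here `R` and `R'` are both modelled as
the function space `G × F → k`; "isomorphism of extensions" means: bijective, preserves
multiplication and comultiplication (the latter via `Δ' ∘ Θ = (Θ ⊗ Θ) ∘ Δ` applied
slotwise), restricts to the identity on the span of `{δ_g 1 : g ∈ G}` (= `k^G`), and
commutes with the projections `π(u)(x) = u(1,x)` onto `kF`. -/
theorem stmt_19 {G F k : Type*} [Group G] [Group F] [Fintype G] [Fintype F]
    [DecidableEq G] [DecidableEq F] [Field k]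
    (act : G → F → G) (lact : G → F → F)
    (hact_mul : ∀ g x y, act g (x * y) = act (act g x) y)
    (hact_one : ∀ g, act g 1 = g)
    (hlact_mul : ∀ s t x, lact (s * t) x = lact s (lact t x))
    (hlact_one : ∀ x, lact 1 x = x)
    (hcomp1 : ∀ s x y, lact s (x * y) = lact s x * lact (act s x) y)
    (hcomp2 : ∀ s t x, act (s * t) x = act s (lact t x) * act t x)
    (σ σ' : G → F → F → kˣ) (τ τ' : F → G → G → kˣ)
    (hσ : ∀ g x y z, σ (act g x) y z * σ g x (y * z) = σ g (x * y) z * σ g x y)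
    (hσ_norm : ∀ g x, σ g x 1 = 1 ∧ σ g 1 x = 1) (hσ_one : ∀ x y, σ 1 x y = 1)
    (hσ' : ∀ g x y z, σ' (act g x) y z * σ' g x (y * z) = σ' g (x * y) z * σ' g x y)
    (hσ'_norm : ∀ g x, σ' g x 1 = 1 ∧ σ' g 1 x = 1) (hσ'_one : ∀ x y, σ' 1 x y = 1)
    (hτ : ∀ x g h l, τ x (g * h) l * τ (lact l x) g h = τ x h l * τ x g (h * l))
    (hτ_norm : ∀ x g, τ x g 1 = 1 ∧ τ x 1 g = 1) (hτ_one : ∀ g h, τ 1 g h = 1)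
    (hτ' : ∀ x g h l, τ' x (g * h) l * τ' (lact l x) g h = τ' x h l * τ' x g (h * l))
    (hτ'_norm : ∀ x g, τ' x g 1 = 1 ∧ τ' x 1 g = 1) (hτ'_one : ∀ g h, τ' 1 g h = 1)
    -- multiplications of `R` and `R'`
    (mul mul' : (G × F → k) → (G × F → k) → (G × F → k))
    (hmul : ∀ u v p, mul u v p = ∑ a : G × F, ∑ b : G × F,
      (if p.1 = a.1 ∧ b.1 = act a.1 a.2 ∧ p.2 = a.2 * b.2 then (σ a.1 a.2 b.2 : k) else 0)
        * u a * v b)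
    (hmul' : ∀ u v p, mul' u v p = ∑ a : G × F, ∑ b : G × F,
      (if p.1 = a.1 ∧ b.1 = act a.1 a.2 ∧ p.2 = a.2 * b.2 then (σ' a.1 a.2 b.2 : k) else 0)
        * u a * v b)
    -- comultiplications of `R` and `R'`
    (Δ Δ' : (G × F → k) → ((G × F) × (G × F) → k))
    (hΔ : ∀ u q, Δ u q = if q.1.2 = lact q.2.1 q.2.2
      then (τ q.2.2 q.1.1 q.2.1 : k) * u (q.1.1 * q.2.1, q.2.2) else 0)
    (hΔ' : ∀ u q, Δ' u q = if q.1.2 = lact q.2.1 q.2.2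
      then (τ' q.2.2 q.1.1 q.2.1 : k) * u (q.1.1 * q.2.1, q.2.2) else 0)
    (ν : G → F → kˣ)
    (hν1 : ∀ x, ν 1 x = 1) (hν2 : ∀ g, ν g 1 = 1)
    (Θ : (G × F → k) → (G × F → k))
    (hΘ : ∀ u p, Θ u p = (ν p.1 p.2 : k) * u p) :
    -- (a) Θ is an isomorphism of extensions iff the two relations hold
    ((Function.Bijective Θ ∧
      (∀ u v, Θ (mul u v) = mul' (Θ u) (Θ v)) ∧
      (∀ u q, Δ' (Θ u) q = Θ (fun q2 => Θ (fun q1 => Δ u (q1, q2)) q.1) q.2) ∧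
      (∀ u : G × F → k, (∀ p : G × F, p.2 ≠ 1 → u p = 0) → Θ u = u) ∧
      (∀ u x, Θ u (1, x) = u (1, x)))
     ↔
     ((∀ g x y, σ g x y * ν g (x * y) = σ' g x y * ν g x * ν (act g x) y) ∧
      (∀ g h x, τ' x g h * ν (g * h) x = τ x g h * ν g (lact h x) * ν h x))) ∧
    -- (b) every isomorphism of extensions is of this form, for a unique ν
    (∀ Θ' : (G × F → k) →ₗ[k] (G × F → k),
      (Function.Bijective Θ' ∧
       (∀ u v, Θ' (mul u v) = mul' (Θ' u) (Θ' v)) ∧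
       (∀ u q, Δ' (Θ' u) q = Θ' (fun q2 => Θ' (fun q1 => Δ u (q1, q2)) q.1) q.2) ∧
       (∀ u : G × F → k, (∀ p : G × F, p.2 ≠ 1 → u p = 0) → Θ' u = u) ∧
       (∀ u x, Θ' u (1, x) = u (1, x))) →
      ∃! ν' : G → F → kˣ,
        (∀ x, ν' 1 x = 1) ∧ (∀ g, ν' g 1 = 1) ∧
        (∀ u p, Θ' u p = (ν' p.1 p.2 : k) * u p)) := by
  have hmul_single (g : G) (v : G × F → k) (p : G × F) :
      mul (Pi.single (g, 1) 1) v p = if p.1 = g then v p else 0 := by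
    rw [hmul, bicrossed_single_one_mul_apply act hact_one σ hσ_norm]
  have hmul_single' (g : G) (v : G × F → k) (p : G × F) :
      mul' (Pi.single (g, 1) 1) v p = if p.1 = g then v p else 0 := by
    rw [hmul', bicrossed_single_one_mul_apply act hact_one σ' hσ'_norm]
  simp only [bicrossed_mul_apply] at hmul hmul'
  refine ⟨⟨?_, ?_⟩, ?_⟩
  · rintro ⟨-, hm, hc, -, -⟩
    constructor
    · intro g x y
      have h := congrFun (hm (Pi.single (g, x) 1) (Pi.single (act g x, y) 1)) (g, x * y)
      rw [hΘ, hmul, hmul', Finset.sum_eq_single x, Finset.sum_eq_single x] at h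
      · simp only [hΘ, inv_mul_cancel_left, Pi.single_eq_same, mul_one] at h
        ext
        push_cast
        rw [mul_comm, h]
      · intro z _ hz
        simp [hΘ, Pi.single_apply, hz]
      · simp
      · intro z _ hz
        simp [Pi.single_apply, hz]
      · simp
    · intro g h x
      have hq := hc (fun _ => 1) ((g, lact h x), (h, x))
      simp only [hΘ, hΔ, hΔ', if_true, mul_one] at hq
      ext
      push_cast
      rw [hq]
      ring
  · rintro ⟨hm, hc⟩
    refine ⟨⟨?_, ?_⟩, ?_, ?_, ?_, ?_⟩
    · intro u v huv
      ext p
      have h := congrFun huv p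
      rw [hΘ, hΘ] at h
      exact (ν p.1 p.2).isUnit.mul_left_cancel h
    · intro v
      refine ⟨fun p => ((ν p.1 p.2)⁻¹ : kˣ) * v p, ?_⟩
      ext p
      rw [hΘ, Units.mul_inv_cancel_left]
    · intro u v
      ext p
      rw [hΘ, hmul, hmul', Finset.mul_sum]
      refine Finset.sum_congr rfl fun x _ => ?_
      have h := congrArg (Units.val) (hm p.1 x (x⁻¹ * p.2))
      rw [mul_inv_cancel_left] at h
      push_cast at h
      simp only [hΘ]
      linear_combination u (p.1, x) * v (act p.1 x, x⁻¹ * p.2) * h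
    · rintro u ⟨⟨g, y⟩, h, x⟩
      simp only [hΘ, hΔ, hΔ']
      split_ifs with hy
      · subst hy
        have h := congrArg (Units.val) (hc g h x)
        push_cast at h
        linear_combination u _ * h
      · simp
    · rintro u hu
      ext ⟨g, x⟩
      rw [hΘ]
      by_cases hx : x = 1
      · simp [hx, hν2]
      · simp [hu (g, x) hx]
    · intro u x
      simp [hΘ, hν1]
  · rintro Θ' ⟨⟨hinj, -⟩, hm, hc, hid, hπ⟩
    have hfix (g : G) : Θ' (Pi.single (g, 1) 1) = Pi.single (g, 1) 1 := by
      refine hid _ fun p hp => Pi.single_eq_of_ne ?_ _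
      rintro rfl
      exact hp rfl
    have hdiag (u : G × F → k) (p : G × F) :
        Θ' u p = Θ' (Pi.single p 1) p * u p := by
      obtain ⟨g, y⟩ := p
      have h1 := hc u ((g, y), (1, y))
      rw [hπ, hΔ'] at h1
      simp only [hlact_one, if_true, (hτ'_norm _ _).1, Units.val_one, one_mul, mul_one] at h1
      have h2 := congrFun (hm (Pi.single (g, 1) 1) (fun q => Δ u (q, (1, y)))) (g, y)
      rw [hfix, hmul_single', if_pos rfl, ← h1] at h2
      have h3 : mul (Pi.single (g, 1) 1) (fun q => Δ u (q, (1, y))) =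
          u (g, y) • Pi.single (g, y) 1 := by
        ext ⟨h, x⟩
        rw [hmul_single, hΔ]
        by_cases hg : h = g <;> by_cases hx : x = y <;>
          simp [hg, hx, hlact_one, (hτ_norm _ _).1]
      rw [← h2, h3, map_smul, Pi.smul_apply, smul_eq_mul, mul_comm]
    have hne (p : G × F) : Θ' (Pi.single p 1) p ≠ 0 := by
      intro h0
      have h1 : Θ' (Pi.single p 1) = Θ' 0 := by
        ext q
        rw [hdiag, map_zero]
        by_cases hq : q = p
        · simp [hq, h0]
        · simp [hq]
      simpa using congrFun (hinj h1) p
    refine ⟨fun g x => Units.mk0 _ (hne (g, x)), ⟨?_, ?_, ?_⟩, ?_⟩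
    · intro x
      ext
      simp [hπ]
    · intro g
      ext
      simp [hfix]
    · exact hdiag
    · rintro ν' ⟨-, -, h⟩
      ext g x
      simp [h]
end
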